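/- Let p : ℝ² → ℝ be smooth, nonnegative, supported in B(0,1/2), with ∫ p = 1, and let h : 𝕋² → ℝ be bounded measurable. Define K₂ := K̄₂ + h on the torus (K̄₂ being evaluated at the periodic representative in [−1/2,1/2]²). Then there exists a constant C, depending only on p and ‖h‖_{L^∞}, such that for every ε ∈ (0, 1/4], |∫_{𝕋²} (K₂ ∗ p^ε (x))² dx − (1/(4π)) ln(1/ε)| ≤ C, where ∗ denotes convolution on the torus and p^ε(x) := ε⁻² p(x/ε). -/

import Mathlib

open MeasureTheory Real

noncomputable section

/-- The fundamental square `[−1/2,1/2]²` of the flat torus `𝕋²`. -/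
def sq2 : Set (EuclideanSpace ℝ (Fin 2)) :=
  {x | ∀ i, x i ∈ Set.Icc (-(1/2) : ℝ) (1/2)}

/-- Second component of the planar Biot–Savart kernel: `K̄₂(x) = x₁/(2π|x|²)`. -/
def Kbar2 (x : EuclideanSpace ℝ (Fin 2)) : ℝ := x 0 / (2 * π * ‖x‖ ^ 2)

/-- Reduction of a point of `ℝ²` to its periodic representative in `[−1/2,1/2)²`. -/
def rep2 (x : EuclideanSpace ℝ (Fin 2)) : EuclideanSpace ℝ (Fin 2) :=
  (WithLp.equiv 2 (Fin 2 → ℝ)).symm fun i => Int.fract (x i + 1/2) - 1/2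

abbrev E2 := EuclideanSpace ℝ (Fin 2)

lemma rep2_apply (x : E2) (i : Fin 2) : rep2 x i = Int.fract (x i + 1/2) - 1/2 := rfl

lemma measurable_rep2 : Measurable rep2 := by
  unfold rep2
  refine (PiLp.continuous_toLp 2 (fun _ : Fin 2 => ℝ)).measurable.comp ?_
  refine measurable_pi_lambda _ fun i => ?_
  refine Measurable.sub_const ?_ _
  refine measurable_fract.comp ?_
  exact ((EuclideanSpace.proj (𝕜 := ℝ) i).continuous.measurable).add_const _

lemma measurable_Kbar2 : Measurable Kbar2 := by
  unfold Kbar2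
  exact ((EuclideanSpace.proj (𝕜 := ℝ) (0 : Fin 2)).continuous.measurable).div (by fun_prop)

lemma coord_le (x : E2) (i : Fin 2) : |x i| ≤ ‖x‖ := by
  simpa using PiLp.norm_apply_le x i

lemma abs_Kbar2_le (x : E2) : |Kbar2 x| ≤ ‖x‖⁻¹ := by
  unfold Kbar2
  by_cases hx : x = 0
  · simp [hx]
  have hn : 0 < ‖x‖ := norm_pos_iff.2 hx
  have hpi := Real.pi_gt_three
  rw [abs_div, abs_of_pos (show 0 < 2 * π * ‖x‖ ^ 2 by positivity), div_le_iff₀ (by positivity)]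
  have := coord_le x 0
  have h2 : ‖x‖⁻¹ * (2 * π * ‖x‖ ^ 2) = 2 * π * ‖x‖ := by field_simp
  rw [h2]; nlinarith

lemma Kbar2_sub_le (x z : E2) (hx : x ≠ 0) (hz : z ≠ 0) :
    |Kbar2 z - Kbar2 x| ≤ ‖z - x‖ / (‖z‖ * ‖x‖) := by
  have h := dist_div_norm_sq_smul hz hx 1
  have hc := coord_le ((1 / ‖z‖) ^ 2 • z - (1 / ‖x‖) ^ 2 • x) 0
  rw [← dist_eq_norm, h, dist_eq_norm] at hc
  have hpi := Real.pi_gt_three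
  have hxn : 0 < ‖x‖ := norm_pos_iff.2 hx
  have hzn : 0 < ‖z‖ := norm_pos_iff.2 hz
  have e : Kbar2 z - Kbar2 x = (((1 / ‖z‖) ^ 2 • z - (1 / ‖x‖) ^ 2 • x) 0) * (1 / (2 * π)) := by
    simp [Kbar2]; field_simp
  rw [e, abs_mul, abs_of_pos (show 0 < 1 / (2 * π) by positivity)]
  have h1 : 1 / (2 * π) ≤ 1 := by
    rw [div_le_one (by positivity)]; linarith
  calc _ ≤ |((1 / ‖z‖) ^ 2 • z - (1 / ‖x‖) ^ 2 • x) 0| * 1 := by gcongr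
    _ ≤ _ := by
      rw [mul_one]; refine hc.trans (le_of_eq ?_); ring

lemma rep2_eq_self (x : E2) (hx : ‖x‖ < 1/2) : rep2 x = x := by
  ext i
  rw [rep2_apply]
  have := abs_le.1 (coord_le x i)
  rw [Int.fract_eq_self.2 ⟨by linarith, by linarith⟩]; ring

lemma le_norm_rep2 (x w : E2) (hx : x ∈ sq2) : ‖x‖ - ‖w‖ ≤ ‖rep2 (x - w)‖ := by
  have h1 : ‖x‖ ≤ ‖rep2 (x - w) + w‖ := by
    rw [EuclideanSpace.norm_eq, EuclideanSpace.norm_eq]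
    apply Real.sqrt_le_sqrt
    refine Finset.sum_le_sum fun i _ => ?_
    rw [Real.norm_eq_abs, Real.norm_eq_abs, sq_abs, sq_abs]
    obtain ⟨ha, hb⟩ := hx i
    have e : (rep2 (x - w) + w) i = x i - ⌊x i - w i + 1/2⌋ := by
      simp only [PiLp.add_apply, rep2_apply, PiLp.sub_apply, Int.fract]; ring
    rw [e]
    generalize ⌊x i - w i + 1/2⌋ = k
    rcases lt_trichotomy k 0 with hk | hk | hk
    · have : (k : ℝ) ≤ -1 := by exact_mod_cast (by omega : k ≤ -1)
      nlinarith
    · simp [hk]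
    · have : (1 : ℝ) ≤ k := by exact_mod_cast (by omega : 1 ≤ k)
      nlinarith
  have := norm_add_le (rep2 (x - w)) w
  linarith

lemma locInt : LocallyIntegrable (fun x : E2 => ‖x‖⁻¹) := by
  refine locallyIntegrable_of_norm_le_rpow (C := 1) (α := 1) (by simp) (by simp) ?_ ?_
  · refine Filter.Eventually.of_forall fun x => ?_
    simp [Real.rpow_neg_one]
  · exact (by fun_prop : Measurable fun x : E2 => ‖x‖⁻¹).aestronglyMeasurable

lemma sq2_eq : sq2 = ⋂ i : Fin 2, (fun x : E2 => x i) ⁻¹' Set.Icc (-(1/2) : ℝ) (1/2) := by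
  ext x; simp [sq2]

lemma isClosed_sq2 : IsClosed sq2 := by
  rw [sq2_eq]
  exact isClosed_iInter fun i =>
    isClosed_Icc.preimage (EuclideanSpace.proj (𝕜 := ℝ) i).continuous

lemma sq2_subset : sq2 ⊆ Metric.closedBall (0 : E2) 1 := by
  intro x hx
  rw [mem_closedBall_zero_iff, EuclideanSpace.norm_eq, Real.sqrt_le_iff, Fin.sum_univ_two]
  refine ⟨by norm_num, ?_⟩
  obtain ⟨a, b⟩ := hx 0
  obtain ⟨c, d⟩ := hx 1
  rw [Real.norm_eq_abs, Real.norm_eq_abs, sq_abs, sq_abs]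
  nlinarith

lemma isCompact_sq2 : IsCompact sq2 :=
  (isCompact_closedBall (0 : E2) 1).of_isClosed_subset isClosed_sq2 sq2_subset

lemma ball_subset_sq2 (x : E2) (hx : ‖x‖ ≤ 1/2) : x ∈ sq2 := by
  intro i
  have := abs_le.1 ((coord_le x i).trans hx)
  exact ⟨by linarith, by linarith⟩

lemma integrable_pow (n : ℕ) (hn : 2 < n) : Integrable (fun x : E2 => ((1 + ‖x‖) ^ n)⁻¹) := by
  have := integrable_one_add_norm (E := E2) (μ := volume) (r := n) (by simpa using hn)
  refine this.congr (Filter.Eventually.of_forall fun x => ?_)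
  simp only
  rw [Real.rpow_neg (by positivity), Real.rpow_natCast]

/-- uniform bound for the convolution with `1/|x|` -/
lemma conv_bound (p : E2 → ℝ) (hpint : Integrable p) (hp0 : ∀ x, 0 ≤ p x) (S : ℝ)
    (hS : ∀ x, p x ≤ S) (hpi : (∫ x : E2, p x) = 1) :
    ∃ B : ℝ, 0 ≤ B ∧ ∀ w : E2, Integrable (fun u => ‖w - u‖⁻¹ * p u) ∧
      ∫ u, ‖w - u‖⁻¹ * p u ≤ B := by
  have hS0 : 0 ≤ S := (hp0 0).trans (hS 0)
  set J : E2 → ℝ := (Metric.closedBall (0 : E2) 1).indicator (fun x => ‖x‖⁻¹) with hJ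
  have hJi : Integrable J := by
    rw [hJ, integrable_indicator_iff Metric.isClosed_closedBall.measurableSet]
    exact locInt.integrableOn_isCompact (isCompact_closedBall _ _)
  have hJ0 : ∀ x, 0 ≤ J x := fun x => Set.indicator_nonneg (fun _ _ => by positivity) x
  refine ⟨1 + S * ∫ x, J x, by
    have : 0 ≤ ∫ x, J x := integral_nonneg (fun x => hJ0 x)
    positivity, fun w => ?_⟩
  have hJw : Integrable (fun u => J (w - u)) := hJi.comp_sub_left w
  have hb : Integrable (fun u => p u + S * J (w - u)) := hpint.add (hJw.const_mul S)
  have hle : ∀ u, ‖w - u‖⁻¹ * p u ≤ p u + S * J (w - u) := by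
    intro u
    by_cases h : ‖w - u‖ ≤ 1
    · have : J (w - u) = ‖w - u‖⁻¹ := by
        rw [hJ, Set.indicator_of_mem]; simpa using h
      rw [this, mul_comm]
      have := mul_le_mul_of_nonneg_right (hS u) (inv_nonneg.2 (norm_nonneg (w - u)))
      linarith [hp0 u]
    · push Not at h
      have h1 : ‖w - u‖⁻¹ ≤ 1 := inv_le_one_of_one_le₀ h.le
      have := mul_le_mul_of_nonneg_right h1 (hp0 u)
      have := mul_nonneg hS0 (hJ0 (w - u))
      linarith
  have hi : Integrable (fun u => ‖w - u‖⁻¹ * p u) := by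
    refine hb.mono' ?_ (Filter.Eventually.of_forall fun u => ?_)
    · exact (by fun_prop : Measurable fun u : E2 => ‖w - u‖⁻¹).aestronglyMeasurable.mul
        hpint.aestronglyMeasurable
    · rw [Real.norm_eq_abs, abs_of_nonneg (mul_nonneg (by positivity) (hp0 u))]
      exact hle u
  refine ⟨hi, ?_⟩
  calc _ ≤ ∫ u, p u + S * J (w - u) := integral_mono hi hb hle
    _ = _ := by
      rw [integral_add hpint (hJw.const_mul S), hpi, integral_const_mul,
        integral_sub_left_eq_self (fun u => J u)]

/-- truncated kernel -/
def gtr (ε : ℝ) (x : E2) : ℝ := if ε ≤ ‖x‖ ∧ ‖x‖ ≤ 1/2 then Kbar2 x else 0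

lemma measurable_gtr (ε : ℝ) : Measurable (gtr ε) := by
  unfold gtr
  refine Measurable.ite ?_ measurable_Kbar2 measurable_const
  exact (measurableSet_le measurable_const measurable_norm).inter
    (measurableSet_le measurable_norm measurable_const)

def rad (ε : ℝ) (t : ℝ) : ℝ := if ε ≤ t ∧ t ≤ 1/2 then (t ^ 2)⁻¹ else 0

lemma integrable_rad (ε : ℝ) (hε : 0 < ε) (f : E2 → ℝ) (hf : Measurable f)
    (hfl : ∀ x, |f x| ≤ rad ε ‖x‖) : Integrable f := by
  have : Integrable ((Metric.closedBall (0 : E2) 1).indicator (fun x => (ε ^ 2)⁻¹)) := by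
    rw [integrable_indicator_iff Metric.isClosed_closedBall.measurableSet]
    exact integrableOn_const (isCompact_closedBall _ _).measure_lt_top.ne
  refine this.mono' hf.aestronglyMeasurable (Filter.Eventually.of_forall fun x => ?_)
  refine (hfl x).trans ?_
  unfold rad
  split_ifs with h
  · rw [Set.indicator_of_mem (by simpa using h.2.trans (by norm_num))]
    have := h.1
    gcongr
  · exact Set.indicator_nonneg (fun _ _ => by positivity) x

lemma measurable_rad (ε : ℝ) : Measurable (rad ε) := by
  unfold rad
  refine Measurable.ite ?_ (by fun_prop) measurable_const
  exact (measurableSet_le measurable_const measurable_id).inter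
    (measurableSet_le measurable_id measurable_const)

lemma gtr_sq (ε : ℝ) (x : E2) :
    gtr ε x ^ 2 = (1 / (4 * π ^ 2)) * (x 0 ^ 2 * (‖x‖ ^ 2)⁻¹ * rad ε ‖x‖) := by
  unfold gtr rad
  split_ifs with h
  · unfold Kbar2; by_cases hx : x = 0
    · simp [hx]
    · have : ‖x‖ ≠ 0 := norm_ne_zero_iff.2 hx
      field_simp; ring
  · simp

lemma coord_rad (ε : ℝ) (i : Fin 2) (x : E2) : |x i ^ 2 * (‖x‖ ^ 2)⁻¹ * rad ε ‖x‖| ≤ rad ε ‖x‖ := by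
  have hr : 0 ≤ rad ε ‖x‖ := by unfold rad; split_ifs <;> positivity
  rw [abs_of_nonneg (by positivity)]
  have : x i ^ 2 * (‖x‖ ^ 2)⁻¹ ≤ 1 := by
    have := coord_le x i
    rw [← div_eq_mul_inv]
    refine div_le_one_of_le₀ ?_ (by positivity)
    rw [← sq_abs (x i)]; gcongr
  nlinarith

lemma measurable_coord_rad (ε : ℝ) (i : Fin 2) :
    Measurable (fun x : E2 => x i ^ 2 * (‖x‖ ^ 2)⁻¹ * rad ε ‖x‖) := by
  have := (EuclideanSpace.proj (𝕜 := ℝ) i).continuous.measurable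
  exact ((Measurable.pow_const this 2).mul (by fun_prop)).mul ((measurable_rad ε).comp measurable_norm)

lemma integral_rad (ε : ℝ) (hε : ε ∈ Set.Ioc (0 : ℝ) (1/4)) :
    ∫ x : E2, rad ε ‖x‖ = 2 * π * Real.log (1 / (2 * ε)) := by
  obtain ⟨h0, h1⟩ := hε
  rw [integral_fun_norm_addHaar volume (rad ε)]
  have hv : (volume : Measure E2).real (Metric.ball 0 1) = π := by
    simp [Measure.real, Real.pi_nonneg]
  have h2 : ∫ y in Set.Ioi (0 : ℝ), y ^ (Module.finrank ℝ E2 - 1) • rad ε y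
      = ∫ y in ε..(1/2), 1 / y := by
    rw [intervalIntegral.integral_of_le (by linarith), ← integral_Icc_eq_integral_Ioc,
      ← integral_indicator measurableSet_Ioi, ← integral_indicator measurableSet_Icc]
    congr 1; ext y
    unfold rad
    by_cases hy : y ∈ Set.Icc ε (1/2)
    · have hy0 : 0 < y := h0.trans_le hy.1
      rw [Set.indicator_of_mem hy, Set.indicator_of_mem (by exact hy0), if_pos (Set.mem_Icc.1 hy)]
      simp; field_simp
    · rw [Set.indicator_of_notMem hy]
      by_cases hy0 : y ∈ Set.Ioi (0 : ℝ)
      · rw [Set.indicator_of_mem hy0, if_neg (fun h => hy (Set.mem_Icc.2 h))]; simp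
      · rw [Set.indicator_of_notMem hy0]
  rw [h2, integral_one_div_of_pos h0 (by norm_num), hv]
  simp only [finrank_euclideanSpace, Fintype.card_fin, nsmul_eq_mul, smul_eq_mul]
  rw [show (1 / 2 / ε : ℝ) = 1 / (2 * ε) by field_simp]
  push_cast; ring

lemma integral_gtr_sq (ε : ℝ) (hε : ε ∈ Set.Ioc (0 : ℝ) (1/4)) :
    ∫ x : E2, gtr ε x ^ 2 = 1 / (4 * π) * Real.log (1 / (2 * ε)) := by
  have hI : ∀ i : Fin 2, Integrable (fun x : E2 => x i ^ 2 * (‖x‖ ^ 2)⁻¹ * rad ε ‖x‖) := fun i =>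
    integrable_rad ε hε.1 _ (measurable_coord_rad ε i) (coord_rad ε i)
  have hsw : ∫ x : E2, x 0 ^ 2 * (‖x‖ ^ 2)⁻¹ * rad ε ‖x‖
      = ∫ x : E2, x 1 ^ 2 * (‖x‖ ^ 2)⁻¹ * rad ε ‖x‖ := by
    set e : E2 ≃ₗᵢ[ℝ] E2 := LinearIsometryEquiv.piLpCongrLeft 2 ℝ ℝ (Equiv.swap (0 : Fin 2) 1)
    have := e.measurePreserving.integral_comp e.toHomeomorph.measurableEmbedding
      (fun x : E2 => x 1 ^ 2 * (‖x‖ ^ 2)⁻¹ * rad ε ‖x‖)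
    rw [← this]
    congr 1; ext x
    rw [e.norm_map]
    congr 3
  have hsum : (∫ x : E2, x 0 ^ 2 * (‖x‖ ^ 2)⁻¹ * rad ε ‖x‖)
      + (∫ x : E2, x 1 ^ 2 * (‖x‖ ^ 2)⁻¹ * rad ε ‖x‖) = 2 * π * Real.log (1 / (2 * ε)) := by
    rw [← integral_rad ε hε, ← integral_add (hI 0) (hI 1)]
    congr 1; ext x
    have hn : ‖x‖ ^ 2 = x 0 ^ 2 + x 1 ^ 2 := by
      rw [EuclideanSpace.norm_sq_eq, Fin.sum_univ_two]; simp
    by_cases hx : x = 0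
    · have : rad ε ‖x‖ = 0 := by
        unfold rad; rw [if_neg]; simp [hx, hε.1]
      rw [this]; simp
    · have : ‖x‖ ≠ 0 := norm_ne_zero_iff.2 hx
      rw [← add_mul, ← add_mul, ← hn, mul_inv_cancel₀ (by positivity), one_mul]
  simp_rw [gtr_sq]
  rw [integral_const_mul]
  have : (∫ x : E2, x 0 ^ 2 * (‖x‖ ^ 2)⁻¹ * rad ε ‖x‖) = π * Real.log (1 / (2 * ε)) := by
    rw [← hsw] at hsum; linarith
  rw [this]
  field_simp

lemma avg_bound (p : E2 → ℝ) (hpint : Integrable p) (hp0 : ∀ x, 0 ≤ p x)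
    (hpi : (∫ x : E2, p x) = 1) (f : E2 → ℝ) (hf : Measurable f) (c D : ℝ)
    (hD : ∀ u, p u ≠ 0 → |f u - c| ≤ D) : |(∫ u, f u * p u) - c| ≤ D := by
  have hb : ∀ u, ‖(f u - c) * p u‖ ≤ D * p u := by
    intro u
    rw [norm_mul, Real.norm_eq_abs, Real.norm_eq_abs, abs_of_nonneg (hp0 u)]
    by_cases h : p u = 0
    · simp [h]
    · exact mul_le_mul_of_nonneg_right (hD u h) (hp0 u)
  have hi : Integrable (fun u => (f u - c) * p u) :=
    (hpint.const_mul D).mono' ((hf.sub_const c).aestronglyMeasurable.mul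
      hpint.aestronglyMeasurable) (Filter.Eventually.of_forall hb)
  have e : (∫ u, f u * p u) - c = ∫ u, (f u - c) * p u := by
    have : ∫ u, f u * p u = ∫ u, ((f u - c) * p u + c * p u) := by
      congr 1; ext u; ring
    rw [this, integral_add hi (hpint.const_mul c), integral_const_mul, hpi]; ring
  rw [e, ← Real.norm_eq_abs]
  have := norm_integral_le_of_norm_le (hpint.const_mul D) (Filter.Eventually.of_forall hb)
  rwa [integral_const_mul, hpi, mul_one] at this

lemma inner_eq (p : E2 → ℝ) (hps : ∀ x, p x ≠ 0 → ‖x‖ < 1/2) (G : E2 → ℝ) (ε : ℝ)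
    (hε : ε ∈ Set.Ioc (0 : ℝ) (1/4)) (x : E2) :
    ∫ y in sq2, G (x - y) * (ε⁻¹ ^ 2 * p (ε⁻¹ • y)) = ∫ u, G (x - ε • u) * p u := by
  obtain ⟨h0, h1⟩ := hε
  rw [setIntegral_eq_integral_of_forall_compl_eq_zero]
  · have := Measure.integral_comp_inv_smul_of_nonneg (volume : Measure E2)
      (fun u => ε⁻¹ ^ 2 * (G (x - ε • u) * p u)) h0.le
    have e : ∀ y : E2, G (x - y) * (ε⁻¹ ^ 2 * p (ε⁻¹ • y))
        = ε⁻¹ ^ 2 * (G (x - ε • (ε⁻¹ • y)) * p (ε⁻¹ • y)) := by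
      intro y; rw [smul_inv_smul₀ h0.ne']; ring
    simp_rw [e]
    rw [this, integral_const_mul]
    simp only [finrank_euclideanSpace, Fintype.card_fin, smul_eq_mul]
    field_simp
  · intro y hy
    by_cases h : p (ε⁻¹ • y) = 0
    · simp [h]
    · exfalso; apply hy
      apply ball_subset_sq2
      have := hps _ h
      rw [norm_smul, norm_inv, Real.norm_eq_abs, abs_of_pos h0, inv_mul_lt_iff₀ h0] at this
      linarith

lemma ptw (p : E2 → ℝ) (hpint : Integrable p) (hp0 : ∀ x, 0 ≤ p x)
    (hps : ∀ x, p x ≠ 0 → ‖x‖ < 1/2) (hpi : (∫ x : E2, p x) = 1) (B : ℝ) (hB0 : 0 ≤ B)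
    (hB : ∀ w : E2, Integrable (fun u => ‖w - u‖⁻¹ * p u) ∧ ∫ u, ‖w - u‖⁻¹ * p u ≤ B)
    (h : E2 → ℝ) (hm : Measurable h) (M : ℝ) (hM : ∀ x, |h x| ≤ M) (ε : ℝ)
    (hε : ε ∈ Set.Ioc (0 : ℝ) (1/4)) (x : E2) (hx : x ∈ sq2) :
    |(∫ u, (Kbar2 (rep2 (x - ε • u)) + h (rep2 (x - ε • u))) * p u) - gtr ε x|
      ≤ (12 + M) + (4 * B + 4) * (ε / (ε + ‖x‖) ^ 2) := by
  obtain ⟨h0, h1⟩ := hε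
  have hM0 : 0 ≤ M := (abs_nonneg _).trans (hM 0)
  have hn := norm_nonneg x
  have hmeas : Measurable (fun u : E2 => Kbar2 (rep2 (x - ε • u)) + h (rep2 (x - ε • u))) := by
    have : Measurable (fun u : E2 => rep2 (x - ε • u)) :=
      measurable_rep2.comp (by fun_prop)
    exact (measurable_Kbar2.comp this).add (hm.comp this)
  have hu : ∀ u, p u ≠ 0 → ‖ε • u‖ ≤ ε / 2 := by
    intro u hu
    have := hps u hu
    rw [norm_smul, Real.norm_eq_abs, abs_of_pos h0]
    nlinarith
  have hρ : 0 ≤ ε / (ε + ‖x‖) ^ 2 := by positivity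
  by_cases c1 : 1/4 ≤ ‖x‖
  · have hg : |gtr ε x| ≤ 4 := by
      unfold gtr
      split_ifs
      · refine (abs_Kbar2_le x).trans ?_
        rw [inv_le_comm₀ (by linarith) (by norm_num)]; linarith
      · simp
    have := avg_bound p hpint hp0 hpi _ hmeas (gtr ε x) (12 + M) (by
      intro u hpu
      have h2 := hu u hpu
      have h3 := le_norm_rep2 x (ε • u) hx
      have h4 : |Kbar2 (rep2 (x - ε • u))| ≤ 8 := by
        refine (abs_Kbar2_le _).trans ?_
        rw [inv_le_comm₀ (by linarith) (by norm_num)]; linarith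
      have h5 := hM (rep2 (x - ε • u))
      rw [abs_le] at *
      constructor <;> linarith)
    nlinarith
  push Not at c1
  have hrep : ∀ u, p u ≠ 0 → rep2 (x - ε • u) = x - ε • u := by
    intro u hpu
    apply rep2_eq_self
    have := norm_sub_le x (ε • u)
    have := hu u hpu
    linarith
  by_cases c2 : ε ≤ ‖x‖
  · have hg : gtr ε x = Kbar2 x := by unfold gtr; rw [if_pos ⟨c2, by linarith⟩]
    have hxp : 0 < ‖x‖ := by linarith
    have := avg_bound p hpint hp0 hpi _ hmeas (gtr ε x) (M + ε / ‖x‖ ^ 2) (by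
      intro u hpu
      have h2 := hu u hpu
      rw [hrep u hpu, hg]
      have h6 : ‖x‖ / 2 ≤ ‖x - ε • u‖ := by
        have := norm_sub_norm_le x (ε • u)
        linarith
      have h3 := Kbar2_sub_le x (x - ε • u) (norm_pos_iff.1 hxp) (norm_pos_iff.1 (by linarith))
      have h4 : ‖x - ε • u - x‖ = ‖ε • u‖ := by rw [sub_sub_cancel_left, norm_neg]
      have h7 : ‖x - ε • u - x‖ / (‖x - ε • u‖ * ‖x‖) ≤ (ε / 2) / (‖x‖ / 2 * ‖x‖) := by
        rw [h4]; gcongr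
      have h8 : (ε / 2) / (‖x‖ / 2 * ‖x‖) = ε / ‖x‖ ^ 2 := by field_simp
      rw [h8] at h7
      have h5 := hM (x - ε • u)
      have h9 := h3.trans h7
      rw [abs_le] at h5 h9 ⊢
      constructor <;> linarith)
    have h10 : ε / ‖x‖ ^ 2 ≤ 4 * (ε / (ε + ‖x‖) ^ 2) := by
      rw [← mul_div_assoc, div_le_div_iff₀ (by positivity) (by positivity)]
      have : (ε + ‖x‖) ^ 2 ≤ 4 * ‖x‖ ^ 2 := by nlinarith
      nlinarith
    nlinarith
  · have hg : gtr ε x = 0 := by unfold gtr; rw [if_neg (fun h => c2 h.1)]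
    push Not at c2
    rw [hg, sub_zero, ← Real.norm_eq_abs]
    obtain ⟨hBi, hBl⟩ := hB (ε⁻¹ • x)
    have hb : ∀ u, ‖(Kbar2 (rep2 (x - ε • u)) + h (rep2 (x - ε • u))) * p u‖
        ≤ ε⁻¹ * (‖ε⁻¹ • x - u‖⁻¹ * p u) + M * p u := by
      intro u
      by_cases hpu : p u = 0
      · simp [hpu]
      rw [hrep u hpu, norm_mul, Real.norm_eq_abs, Real.norm_eq_abs, abs_of_nonneg (hp0 u),
        ← mul_assoc, ← add_mul]
      refine mul_le_mul_of_nonneg_right ?_ (hp0 u)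
      refine (abs_add_le _ _).trans (add_le_add ?_ (hM _))
      refine (abs_Kbar2_le _).trans (le_of_eq ?_)
      have : x - ε • u = ε • (ε⁻¹ • x - u) := by rw [smul_sub, smul_inv_smul₀ h0.ne']
      rw [this, norm_smul, Real.norm_eq_abs, abs_of_pos h0, mul_inv]
    have := norm_integral_le_of_norm_le ((hBi.const_mul ε⁻¹).add (hpint.const_mul M))
      (Filter.Eventually.of_forall hb)
    refine this.trans ?_
    simp only [Pi.add_apply]
    rw [integral_add (hBi.const_mul ε⁻¹) (hpint.const_mul M), integral_const_mul,
      integral_const_mul, hpi]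
    have h11 : ε⁻¹ * (∫ u, ‖ε⁻¹ • x - u‖⁻¹ * p u) ≤ ε⁻¹ * B := by gcongr
    have h12 : ε⁻¹ ≤ 4 * (ε / (ε + ‖x‖) ^ 2) := by
      rw [← mul_div_assoc, ← one_div, div_le_div_iff₀ (by positivity) (by positivity)]
      nlinarith
    nlinarith

lemma scale_int (n : ℕ) (hn : 2 < n) (ε : ℝ) (h0 : 0 < ε) :
    Integrable (fun x : E2 => (ε ^ 2)⁻¹ * ((1 + ‖ε⁻¹ • x‖) ^ n)⁻¹) ∧
    ∫ x : E2, (ε ^ 2)⁻¹ * ((1 + ‖ε⁻¹ • x‖) ^ n)⁻¹ = ∫ x : E2, ((1 + ‖x‖) ^ n)⁻¹ := by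
  constructor
  · exact ((integrable_pow n hn).comp_smul (inv_ne_zero h0.ne')).const_mul _
  · rw [integral_const_mul, Measure.integral_comp_inv_smul_of_nonneg (volume : Measure E2)
      (fun u => ((1 + ‖u‖) ^ n)⁻¹) h0.le]
    simp only [finrank_euclideanSpace, Fintype.card_fin, smul_eq_mul]
    field_simp

lemma scale_eq (n : ℕ) (ε : ℝ) (h0 : 0 < ε) (x : E2) :
    (ε ^ 2)⁻¹ * ((1 + ‖ε⁻¹ • x‖) ^ (n + 2))⁻¹ = ε ^ n / (ε + ‖x‖) ^ (n + 2) := by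
  have h : 1 + ‖ε⁻¹ • x‖ = (ε + ‖x‖) / ε := by
    rw [norm_smul, norm_inv, Real.norm_eq_abs, abs_of_pos h0]; field_simp
  rw [h, div_pow, pow_add ε n 2]
  field_simp

lemma sq_diff_bound (ε : ℝ) (h0 : 0 < ε) (x : E2) (F a b : ℝ) (ha : 0 ≤ a) (hb : 0 ≤ b)
    (hF : |F - gtr ε x| ≤ a + b * (ε / (ε + ‖x‖) ^ 2)) :
    |F ^ 2 - gtr ε x ^ 2| ≤ 2 * a ^ 2 + 2 * a * ‖x‖⁻¹
      + 2 * b ^ 2 * ((ε ^ 2)⁻¹ * ((1 + ‖ε⁻¹ • x‖) ^ 4)⁻¹)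
      + 4 * b * ((ε ^ 2)⁻¹ * ((1 + ‖ε⁻¹ • x‖) ^ 3)⁻¹) := by
  rw [scale_eq 2 ε h0, scale_eq 1 ε h0]
  have hn := norm_nonneg x
  have e4 : ε ^ 2 / (ε + ‖x‖) ^ (2 + 2) = (ε / (ε + ‖x‖) ^ 2) ^ 2 := by field_simp
  have e3 : ε ^ 1 / (ε + ‖x‖) ^ (1 + 2) = (ε / (ε + ‖x‖) ^ 2) * (1 / (ε + ‖x‖)) := by field_simp
  rw [e4, e3]
  have hg1 : |gtr ε x| ≤ ‖x‖⁻¹ := by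
    unfold gtr; split_ifs
    · exact abs_Kbar2_le x
    · simp
  have hg2 : |gtr ε x| ≤ 2 * (1 / (ε + ‖x‖)) := by
    unfold gtr; split_ifs with h
    · refine (abs_Kbar2_le x).trans ?_
      rw [← one_div, ← mul_div_assoc, div_le_div_iff₀ (by linarith) (by linarith)]
      linarith
    · simp; positivity
  have hρ : 0 ≤ ε / (ε + ‖x‖) ^ 2 := by positivity
  generalize ε / (ε + ‖x‖) ^ 2 = ρ at *
  generalize 1 / (ε + ‖x‖) = σ at *
  generalize ‖x‖⁻¹ = τ at *
  generalize gtr ε x = g at *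
  have e : F ^ 2 - g ^ 2 = (F - g) * ((F - g) + 2 * g) := by ring
  rw [e, abs_mul]
  have h2 : |F - g + 2 * g| ≤ (a + b * ρ) + 2 * |g| := by
    refine (abs_add_le _ _).trans (add_le_add hF ?_)
    rw [abs_mul]; simp
  have hbr : 0 ≤ b * ρ := by positivity
  calc _ ≤ (a + b * ρ) * ((a + b * ρ) + 2 * |g|) := by gcongr
    _ = (a + b * ρ) ^ 2 + 2 * (a * |g|) + 2 * (b * ρ * |g|) := by ring
    _ ≤ (2 * a ^ 2 + 2 * (b * ρ) ^ 2) + 2 * (a * τ) + 2 * (b * ρ * (2 * σ)) := by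
      have : (a + b * ρ) ^ 2 ≤ 2 * a ^ 2 + 2 * (b * ρ) ^ 2 := by nlinarith [sq_nonneg (a - b * ρ)]
      gcongr
    _ = _ := by ring

/-- For `p` smooth, nonnegative, supported in `B(0,1/2)` with `∫ p = 1`, and `h` a bounded
measurable function on the torus with `|h| ≤ M`, the torus kernel `K₂ := K̄₂ + h`
satisfies, with a constant `C = C(p, M)`: for all `ε ∈ (0,1/4]`,
`|∫_{𝕋²} (K₂ ∗ p^ε)² dx − (1/(4π)) ln(1/ε)| ≤ C`. -/
theorem torus_kernel_convolution_log_expansion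
    (p : EuclideanSpace ℝ (Fin 2) → ℝ) (hp : ContDiff ℝ (⊤ : ℕ∞) p)
    (hp0 : ∀ x, 0 ≤ p x) (hps : ∀ x, p x ≠ 0 → ‖x‖ < 1/2)
    (hpi : (∫ x : EuclideanSpace ℝ (Fin 2), p x) = 1) (M : ℝ) :
    ∃ C : ℝ, 0 < C ∧
      ∀ h : EuclideanSpace ℝ (Fin 2) → ℝ, Measurable h → (∀ x, |h x| ≤ M) →
      ∀ ε : ℝ, ε ∈ Set.Ioc (0 : ℝ) (1/4) →
        |(∫ x in sq2,
            (∫ y in sq2, (Kbar2 (rep2 (x - y)) + h (rep2 (x - y)))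
              * (ε⁻¹ ^ 2 * p (ε⁻¹ • y))) ^ 2)
          - (1 / (4 * π)) * Real.log (1 / ε)| ≤ C := by
  have hpint : Integrable p := integrable_of_integral_eq_one hpi
  obtain ⟨S, hS⟩ : ∃ S, ∀ x, p x ≤ S := by
    obtain ⟨S, hS⟩ := (isCompact_closedBall (0 : E2) (1/2)).exists_bound_of_continuousOn
      hp.continuous.continuousOn
    refine ⟨max S 0, fun x => ?_⟩
    by_cases h : p x = 0
    · rw [h]; exact le_max_right _ _
    · exact ((le_abs_self _).trans (hS x (by simpa using (hps x h).le))).trans (le_max_left _ _)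
  obtain ⟨B, hB0, hB⟩ := conv_bound p hpint hp0 S hS hpi
  set a : ℝ := 12 + |M| with ha
  set b : ℝ := 4 * B + 4 with hb
  have ha0 : 0 ≤ a := by positivity
  have hb0 : 0 ≤ b := by positivity
  set C0 : ℝ := (∫ x in sq2, (2 * a ^ 2 + 2 * a * ‖x‖⁻¹))
    + 2 * b ^ 2 * (∫ x : E2, ((1 + ‖x‖) ^ 4)⁻¹) + 4 * b * (∫ x : E2, ((1 + ‖x‖) ^ 3)⁻¹) with hC0
  have hC0' : 0 ≤ C0 := by
    have i1 : 0 ≤ ∫ x in sq2, (2 * a ^ 2 + 2 * a * ‖x‖⁻¹) := integral_nonneg fun x => by positivity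
    have i2 : 0 ≤ ∫ x : E2, ((1 + ‖x‖) ^ 4)⁻¹ := integral_nonneg fun x => by positivity
    have i3 : 0 ≤ ∫ x : E2, ((1 + ‖x‖) ^ 3)⁻¹ := integral_nonneg fun x => by positivity
    positivity
  refine ⟨C0 + 1, by linarith, fun h hm hM ε hε => ?_⟩
  have h0 := hε.1
  have hMa : |M| = M := abs_of_nonneg ((abs_nonneg _).trans (hM 0))
  have hin := fun x => inner_eq p hps (fun z => Kbar2 (rep2 z) + h (rep2 z)) ε hε x
  simp_rw [hin]
  set F : E2 → ℝ := fun x => ∫ u, (Kbar2 (rep2 (x - ε • u)) + h (rep2 (x - ε • u))) * p u with hF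
  have hFm : StronglyMeasurable F := by
    refine StronglyMeasurable.integral_prod_right (ν := volume)
      (f := fun x u => (Kbar2 (rep2 (x - ε • u)) + h (rep2 (x - ε • u))) * p u) ?_
    have hr : Measurable (fun q : E2 × E2 => rep2 (q.1 - ε • q.2)) :=
      measurable_rep2.comp (by fun_prop)
    exact (((measurable_Kbar2.comp hr).add (hm.comp hr)).mul
      (hp.continuous.measurable.comp measurable_snd)).stronglyMeasurable
  have hFb : ∀ x ∈ sq2, |F x - gtr ε x| ≤ a + b * (ε / (ε + ‖x‖) ^ 2) := by
    intro x hx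
    rw [ha, hMa]
    exact ptw p hpint hp0 hps hpi B hB0 hB h hm M hM ε hε x hx
  have hms : MeasurableSet sq2 := isClosed_sq2.measurableSet
  have hdom := fun x hx => sq_diff_bound ε h0 x (F x) a b ha0 hb0 (hFb x hx)
  obtain ⟨s4, s4'⟩ := scale_int 4 (by norm_num) ε h0
  obtain ⟨s3, s3'⟩ := scale_int 3 (by norm_num) ε h0
  have q1 : IntegrableOn (fun x : E2 => 2 * a ^ 2 + 2 * a * ‖x‖⁻¹) sq2 :=
    Integrable.add (integrableOn_const isCompact_sq2.measure_lt_top.ne)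
      ((locInt.integrableOn_isCompact isCompact_sq2).const_mul _)
  have q4 := (s4.const_mul (2 * b ^ 2)).integrableOn (s := sq2)
  have q3 := (s3.const_mul (4 * b)).integrableOn (s := sq2)
  have hae := (ae_restrict_iff' (μ := volume) hms).2 (Filter.Eventually.of_forall hdom)
  have hgm := measurable_gtr ε
  have hd : IntegrableOn (fun x => F x ^ 2 - gtr ε x ^ 2) sq2 :=
    ((q1.add q4).add q3).mono'
      ((hFm.measurable.pow_const 2).sub (hgm.pow_const 2)).aestronglyMeasurable hae
  have hgi : Integrable (fun x => gtr ε x ^ 2) := by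
    simp_rw [gtr_sq]
    exact (integrable_rad ε h0 _ (measurable_coord_rad ε 0) (coord_rad ε 0)).const_mul _
  have hgint : ∫ x in sq2, gtr ε x ^ 2 = 1 / (4 * π) * Real.log (1 / (2 * ε)) := by
    rw [← integral_gtr_sq ε hε]
    refine setIntegral_eq_integral_of_forall_compl_eq_zero fun x hx => ?_
    have : gtr ε x = 0 := by
      unfold gtr; rw [if_neg]; exact fun h => hx (ball_subset_sq2 x h.2)
    rw [this]; norm_num
  have hsplit : ∫ x in sq2, F x ^ 2
      = (∫ x in sq2, (F x ^ 2 - gtr ε x ^ 2)) + ∫ x in sq2, gtr ε x ^ 2 := by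
    rw [← integral_add hd hgi.integrableOn]
    congr 1; ext x; ring
  have hdb : |∫ x in sq2, (F x ^ 2 - gtr ε x ^ 2)| ≤ C0 := by
    rw [← Real.norm_eq_abs]
    refine (norm_integral_le_of_norm_le ((q1.add q4).add q3) hae).trans ?_
    rw [integral_add' (q1.add q4) q3, integral_add' q1 q4, hC0, integral_const_mul (2 * b ^ 2),
      integral_const_mul (4 * b), ← s4', ← s3']
    have k4 := setIntegral_le_integral (s := sq2) s4
      (Filter.Eventually.of_forall fun x => by positivity)
    have k3 := setIntegral_le_integral (s := sq2) s3
      (Filter.Eventually.of_forall fun x => by positivity)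
    exact add_le_add (add_le_add le_rfl (mul_le_mul_of_nonneg_left k4 (by positivity)))
      (mul_le_mul_of_nonneg_left k3 (by positivity))
  rw [hsplit, hgint]
  have hlog : Real.log (1 / (2 * ε)) = Real.log (1 / ε) - Real.log 2 := by
    rw [← Real.log_div (by positivity) (by norm_num)]
    congr 1; field_simp
  rw [hlog]
  have hl2 : 0 ≤ Real.log 2 := Real.log_nonneg (by norm_num)
  have hl2' : Real.log 2 ≤ 1 := by have := Real.log_two_lt_d9; linarith
  have hp3 := Real.pi_gt_three
  have hp1 : 1 / (4 * π) ≤ 1 := by rw [div_le_one (by positivity)]; linarith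
  have hp2 : 0 ≤ 1 / (4 * π) := by positivity
  have hm1 : 1 / (4 * π) * Real.log 2 ≤ 1 := mul_le_one₀ hp1 hl2 hl2'
  have hm2 : 0 ≤ 1 / (4 * π) * Real.log 2 := by positivity
  rw [abs_le] at hdb ⊢
  constructor <;> linarith
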